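/- Under Assumptions 1 and 2, let x* = argmin_{x ∈ X^T} C(x; θ) and let ρ = 1 − α/(4L), ζ = h²/α + h²/(2L). For any y ∈ X^T and any inexact parameter θ' ∈ Θ^T, the one-step inexact projected gradient update z = Π_{X^T}[y − (1/(2L)) ∇_x C(y; θ')] satisfies C(z; θ) − C(x*; θ) ≤ L ρ ||y − x*||² + ζ ||θ' − θ||². -/

import Mathlib

open Finset
open scoped RealInnerProductSpace

noncomputable section

/-- The total SOCO cost `C(x; θ) = ∑_{t=1}^T [f(x_t; θ_t) + d(x_t, x_{t-1})]`,
where the initial point is `x 0`. -/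
def socoCost {n p : ℕ} (T : ℕ)
    (f : EuclideanSpace ℝ (Fin n) → EuclideanSpace ℝ (Fin p) → ℝ)
    (d : EuclideanSpace ℝ (Fin n) → EuclideanSpace ℝ (Fin n) → ℝ)
    (θ : ℕ → EuclideanSpace ℝ (Fin p)) (x : ℕ → EuclideanSpace ℝ (Fin n)) : ℝ :=
  ∑ t ∈ Finset.Icc 1 T, (f (x t) (θ t) + d (x t) (x (t - 1)))

/-- The partial gradient of the total cost with respect to `x_t`:
`∇_{x_t} C(x;θ) = ∇_{x_t} f(x_t;θ_t) + ∇_{x_t} d(x_t,x_{t-1}) + ∇_{x_t} d(x_{t+1},x_t)·1_{t ≤ T-1}`,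
where `Gf` is the gradient of `f` in its first argument and `Gd1`, `Gd2` are the partial
gradients of `d` in its first and second arguments. -/
def socoGrad {n p : ℕ} (T : ℕ)
    (Gf : EuclideanSpace ℝ (Fin n) → EuclideanSpace ℝ (Fin p) → EuclideanSpace ℝ (Fin n))
    (Gd1 Gd2 : EuclideanSpace ℝ (Fin n) → EuclideanSpace ℝ (Fin n) → EuclideanSpace ℝ (Fin n))
    (θ : ℕ → EuclideanSpace ℝ (Fin p)) (x : ℕ → EuclideanSpace ℝ (Fin n)) (t : ℕ) :
    EuclideanSpace ℝ (Fin n) :=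
  Gf (x t) (θ t) + Gd1 (x t) (x (t - 1)) + (if t < T then Gd2 (x (t + 1)) (x t) else 0)

/-- Shifting the index of a sum by one when the term at the origin vanishes. -/
theorem sum_Icc_pred_eq_sum_ite {g : ℕ → ℝ} (hg : g 0 = 0) (T : ℕ) :
    ∑ t ∈ Finset.Icc 1 T, g (t - 1) = ∑ t ∈ Finset.Icc 1 T, if t < T then g t else 0 := by
  have key : ∀ m : ℕ, ∑ t ∈ Finset.Icc 1 (m + 1), g (t - 1) = ∑ t ∈ Finset.Icc 1 m, g t := by
    intro m
    induction m with
    | zero => simp [hg]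
    | succ k ih =>
      rw [Finset.sum_Icc_succ_top (by omega), ih, Finset.sum_Icc_succ_top (by omega)]
      simp
  cases T with
  | zero => simp
  | succ m =>
    rw [key, Finset.sum_Icc_succ_top (by omega)]
    simp only [lt_irrefl, if_false, add_zero]
    refine Finset.sum_congr rfl fun t ht => ?_
    rw [if_pos (by have := (Finset.mem_Icc.mp ht).2; omega)]

theorem sum_Icc_pred_le {g : ℕ → ℝ} (hg : g 0 = 0) (hpos : ∀ t, 0 ≤ g t) (T : ℕ) :
    ∑ t ∈ Finset.Icc 1 T, g (t - 1) ≤ ∑ t ∈ Finset.Icc 1 T, g t := by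
  rw [sum_Icc_pred_eq_sum_ite hg]
  refine Finset.sum_le_sum fun t _ => ?_
  split_ifs
  · exact le_rfl
  · exact hpos t

/-- Pairing the gradient of the total cost with a direction vanishing at time `0`, stage by
stage. -/
theorem sum_inner_socoGrad {n p : ℕ} (T : ℕ)
    (Gf : EuclideanSpace ℝ (Fin n) → EuclideanSpace ℝ (Fin p) → EuclideanSpace ℝ (Fin n))
    (Gd1 Gd2 : EuclideanSpace ℝ (Fin n) → EuclideanSpace ℝ (Fin n) → EuclideanSpace ℝ (Fin n))
    (θ : ℕ → EuclideanSpace ℝ (Fin p)) (y v : ℕ → EuclideanSpace ℝ (Fin n)) (hv : v 0 = 0) :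
    ∑ t ∈ Finset.Icc 1 T, ⟪socoGrad T Gf Gd1 Gd2 θ y t, v t⟫ =
      ∑ t ∈ Finset.Icc 1 T, (⟪Gf (y t) (θ t), v t⟫ + ⟪Gd1 (y t) (y (t - 1)), v t⟫
        + ⟪Gd2 (y t) (y (t - 1)), v (t - 1)⟫) := by
  have hshift := sum_Icc_pred_eq_sum_ite (g := fun s => ⟪Gd2 (y (s + 1)) (y s), v s⟫)
    (by simp [hv]) T
  have hpred : ∑ t ∈ Finset.Icc 1 T, ⟪Gd2 (y t) (y (t - 1)), v (t - 1)⟫ =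
      ∑ t ∈ Finset.Icc 1 T, ⟪Gd2 (y (t - 1 + 1)) (y (t - 1)), v (t - 1)⟫ :=
    Finset.sum_congr rfl fun t ht => by rw [Nat.sub_add_cancel (Finset.mem_Icc.mp ht).1]
  rw [Finset.sum_add_distrib, hpred, hshift, ← Finset.sum_add_distrib]
  refine Finset.sum_congr rfl fun t _ => ?_
  unfold socoGrad
  split_ifs <;> simp [inner_add_left]

/-- The total cost is strongly convex. -/
theorem socoCost_add_le {n p T : ℕ}
    {X : Set (EuclideanSpace ℝ (Fin n))} {Θ : Set (EuclideanSpace ℝ (Fin p))}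
    {f : EuclideanSpace ℝ (Fin n) → EuclideanSpace ℝ (Fin p) → ℝ}
    {d : EuclideanSpace ℝ (Fin n) → EuclideanSpace ℝ (Fin n) → ℝ}
    {Gf : EuclideanSpace ℝ (Fin n) → EuclideanSpace ℝ (Fin p) → EuclideanSpace ℝ (Fin n)}
    {Gd1 Gd2 : EuclideanSpace ℝ (Fin n) → EuclideanSpace ℝ (Fin n) → EuclideanSpace ℝ (Fin n)}
    {α : ℝ}
    (hfsc : ∀ θ ∈ Θ, ∀ x ∈ X, ∀ y ∈ X,
      f y θ ≥ f x θ + ⟪Gf x θ, y - x⟫ + α / 2 * ‖y - x‖ ^ 2)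
    (hdcv : ∀ a ∈ X, ∀ b ∈ X, ∀ a' ∈ X, ∀ b' ∈ X,
      d a' b' ≥ d a b + ⟪Gd1 a b, a' - a⟫ + ⟪Gd2 a b, b' - b⟫)
    {θ : ℕ → EuclideanSpace ℝ (Fin p)} (hθ : ∀ t ∈ Finset.Icc 1 T, θ t ∈ Θ)
    {x y : ℕ → EuclideanSpace ℝ (Fin n)} (h₀ : x 0 = y 0)
    (hx : ∀ t ≤ T, x t ∈ X) (hy : ∀ t ≤ T, y t ∈ X) :
    socoCost T f d θ y + ∑ t ∈ Finset.Icc 1 T, ⟪socoGrad T Gf Gd1 Gd2 θ y t, x t - y t⟫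
      + α / 2 * ∑ t ∈ Finset.Icc 1 T, ‖x t - y t‖ ^ 2 ≤ socoCost T f d θ x := by
  rw [sum_inner_socoGrad T Gf Gd1 Gd2 θ y (fun t => x t - y t) (by simp [h₀]), socoCost, socoCost,
    Finset.mul_sum, ← Finset.sum_add_distrib, ← Finset.sum_add_distrib]
  refine Finset.sum_le_sum fun t ht => ?_
  have htT := (Finset.mem_Icc.mp ht).2
  have htT' : t - 1 ≤ T := by omega
  have hf := hfsc (θ t) (hθ t ht) (y t) (hy t htT) (x t) (hx t htT)
  have hd := hdcv (y t) (hy t htT) (y (t - 1)) (hy _ htT') (x t) (hx t htT) (x (t - 1)) (hx _ htT')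
  linarith

theorem inner_add_inner_le_of_sq_add_sq_le {E : Type*} [NormedAddCommGroup E]
    [InnerProductSpace ℝ E] {u v a b : E} {l : ℝ} (hl : 0 ≤ l)
    (h : ‖u‖ ^ 2 + ‖v‖ ^ 2 ≤ l ^ 2 * (‖a‖ ^ 2 + ‖b‖ ^ 2)) :
    ⟪u, a⟫ + ⟪v, b⟫ ≤ l * (‖a‖ ^ 2 + ‖b‖ ^ 2) := by
  have hcs : ‖u‖ * ‖a‖ + ‖v‖ * ‖b‖ ≤ l * (‖a‖ ^ 2 + ‖b‖ ^ 2) := by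
    refine abs_le_of_sq_le_sq' ?_ (by positivity) |>.2
    have hmul := mul_le_mul_of_nonneg_right h (by positivity : 0 ≤ ‖a‖ ^ 2 + ‖b‖ ^ 2)
    nlinarith [sq_nonneg (‖u‖ * ‖b‖ - ‖v‖ * ‖a‖)]
  linarith [real_inner_le_norm u a, real_inner_le_norm v b]

/-- A descent estimate for the total cost, with the smoothness constant `lf + 2 * ld` in place
of its half. -/
theorem socoCost_le_add {n p T : ℕ}
    {X : Set (EuclideanSpace ℝ (Fin n))} {Θ : Set (EuclideanSpace ℝ (Fin p))}
    {f : EuclideanSpace ℝ (Fin n) → EuclideanSpace ℝ (Fin p) → ℝ}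
    {d : EuclideanSpace ℝ (Fin n) → EuclideanSpace ℝ (Fin n) → ℝ}
    {Gf : EuclideanSpace ℝ (Fin n) → EuclideanSpace ℝ (Fin p) → EuclideanSpace ℝ (Fin n)}
    {Gd1 Gd2 : EuclideanSpace ℝ (Fin n) → EuclideanSpace ℝ (Fin n) → EuclideanSpace ℝ (Fin n)}
    {α lf ld : ℝ} (hα : 0 ≤ α) (hld : 0 ≤ ld)
    (hfsc : ∀ θ ∈ Θ, ∀ x ∈ X, ∀ y ∈ X,
      f y θ ≥ f x θ + ⟪Gf x θ, y - x⟫ + α / 2 * ‖y - x‖ ^ 2)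
    (hfsm : ∀ θ ∈ Θ, ∀ x ∈ X, ∀ y ∈ X, ‖Gf x θ - Gf y θ‖ ≤ lf * ‖x - y‖)
    (hdcv : ∀ a ∈ X, ∀ b ∈ X, ∀ a' ∈ X, ∀ b' ∈ X,
      d a' b' ≥ d a b + ⟪Gd1 a b, a' - a⟫ + ⟪Gd2 a b, b' - b⟫)
    (hdsm : ∀ a ∈ X, ∀ b ∈ X, ∀ a' ∈ X, ∀ b' ∈ X,
      ‖Gd1 a b - Gd1 a' b'‖ ^ 2 + ‖Gd2 a b - Gd2 a' b'‖ ^ 2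
        ≤ ld ^ 2 * (‖a - a'‖ ^ 2 + ‖b - b'‖ ^ 2))
    {θ : ℕ → EuclideanSpace ℝ (Fin p)} (hθ : ∀ t ∈ Finset.Icc 1 T, θ t ∈ Θ)
    {z y : ℕ → EuclideanSpace ℝ (Fin n)} (h₀ : z 0 = y 0)
    (hz : ∀ t ≤ T, z t ∈ X) (hy : ∀ t ≤ T, y t ∈ X) :
    socoCost T f d θ z ≤ socoCost T f d θ y
      + ∑ t ∈ Finset.Icc 1 T, ⟪socoGrad T Gf Gd1 Gd2 θ y t, z t - y t⟫
      + (lf + 2 * ld) * ∑ t ∈ Finset.Icc 1 T, ‖z t - y t‖ ^ 2 := by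
  have hshift := sum_Icc_pred_le (g := fun t => ‖z t - y t‖ ^ 2) (by simp [h₀])
    (fun t => by positivity) T
  have hstage : socoCost T f d θ z ≤ socoCost T f d θ y
      + ∑ t ∈ Finset.Icc 1 T, ⟪socoGrad T Gf Gd1 Gd2 θ y t, z t - y t⟫
      + ((lf + ld) * ∑ t ∈ Finset.Icc 1 T, ‖z t - y t‖ ^ 2
        + ld * ∑ t ∈ Finset.Icc 1 T, ‖z (t - 1) - y (t - 1)‖ ^ 2) := by
    rw [sum_inner_socoGrad T Gf Gd1 Gd2 θ y (fun t => z t - y t) (by simp [h₀]), socoCost,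
      socoCost, Finset.mul_sum, Finset.mul_sum, ← Finset.sum_add_distrib,
      ← Finset.sum_add_distrib, ← Finset.sum_add_distrib]
    refine Finset.sum_le_sum fun t ht => ?_
    have htT := (Finset.mem_Icc.mp ht).2
    have htT' : t - 1 ≤ T := by omega
    have hf := hfsc (θ t) (hθ t ht) (z t) (hz t htT) (y t) (hy t htT)
    have hd := hdcv (z t) (hz t htT) (z (t - 1)) (hz _ htT')
      (y t) (hy t htT) (y (t - 1)) (hy _ htT')
    have hdG := inner_add_inner_le_of_sq_add_sq_le hld
      (hdsm (z t) (hz t htT) (z (t - 1)) (hz _ htT') (y t) (hy t htT) (y (t - 1)) (hy _ htT'))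
    have hfG : ⟪Gf (z t) (θ t) - Gf (y t) (θ t), z t - y t⟫ ≤ lf * ‖z t - y t‖ ^ 2 := by
      have hlip := mul_le_mul_of_nonneg_right
        (hfsm (θ t) (hθ t ht) (z t) (hz t htT) (y t) (hy t htT)) (norm_nonneg (z t - y t))
      linarith [real_inner_le_norm (Gf (z t) (θ t) - Gf (y t) (θ t)) (z t - y t)]
    rw [← neg_sub (z t) (y t), inner_neg_right, norm_neg] at hf
    rw [← neg_sub (z t) (y t), ← neg_sub (z (t - 1)) (y (t - 1)), inner_neg_right,
      inner_neg_right] at hd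
    rw [inner_sub_left] at hfG
    rw [inner_sub_left, inner_sub_left] at hdG
    have hsq : 0 ≤ α / 2 * ‖z t - y t‖ ^ 2 := by positivity
    linarith
  linarith [mul_le_mul_of_nonneg_left hshift hld]

theorem inner_sub_sub_nonpos_of_forall_norm_le {E : Type*} [NormedAddCommGroup E]
    [InnerProductSpace ℝ E] {K : Set E} (hK : Convex ℝ K) {u z : E} (hz : z ∈ K)
    (hmin : ∀ w ∈ K, ‖z - u‖ ^ 2 ≤ ‖w - u‖ ^ 2) {w : E} (hw : w ∈ K) :
    ⟪u - z, w - z⟫ ≤ 0 := by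
  refine (norm_eq_iInf_iff_real_inner_le_zero hK hz).mp ?_ w hw
  have : Nonempty K := ⟨⟨z, hz⟩⟩
  refine le_antisymm (le_ciInf fun v => ?_) (ciInf_le ⟨0, ?_⟩ (⟨z, hz⟩ : K))
  · rw [norm_sub_rev u z, norm_sub_rev u v]
    exact le_of_sq_le_sq (hmin v v.2) (norm_nonneg _)
  · rintro _ ⟨v, rfl⟩
    exact norm_nonneg _

/-- One step of inexact projected gradient: `g` is the exact gradient at `y`, `g'` the inexact one,
and `hvi` the variational inequality for the projection `z` of the gradient step. -/
theorem inner_add_norm_sq_le_of_projected_step {E : Type*} [NormedAddCommGroup E]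
    [InnerProductSpace ℝ E] {g g' x y z : E} {L : ℝ} (hL : 0 < L)
    (hvi : ⟪y - (1 / (2 * L)) • g' - z, x - z⟫ ≤ 0) :
    ⟪g, z - x⟫ + L * ‖z - y‖ ^ 2 ≤ L * ‖y - x‖ ^ 2 + ‖g - g'‖ ^ 2 / (4 * L) := by
  obtain ⟨q, rfl⟩ : ∃ q, z = y + q := ⟨z - y, by abel⟩
  obtain ⟨r, rfl⟩ : ∃ r, x = y + q - r := ⟨y + q - x, by abel⟩
  have hvi' : 2 * L * ⟪q, r⟫ + ⟪g', r⟫ ≤ 0 := by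
    have e : ⟪y - (1 / (2 * L)) • g' - (y + q), y + q - r - (y + q)⟫
        = (2 * L * ⟪q, r⟫ + ⟪g', r⟫) / (2 * L) := by
      rw [show y - (1 / (2 * L)) • g' - (y + q) = -((1 / (2 * L)) • g' + q) by abel,
        show y + q - r - (y + q) = -r by abel, inner_neg_neg, inner_add_left,
        real_inner_smul_left]
      field_simp
      ring
    rw [e] at hvi
    by_contra! hpos
    exact absurd (div_pos hpos (by positivity : 0 < 2 * L)) (not_lt.mpr hvi)
  have hyoung : ⟪g - g', r⟫ ≤ ‖g - g'‖ ^ 2 / (4 * L) + L * ‖r‖ ^ 2 := by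
    have hsq : ‖g - g'‖ ^ 2 / (4 * L) + L * ‖r‖ ^ 2 - ‖g - g'‖ * ‖r‖
        = (‖g - g'‖ - 2 * L * ‖r‖) ^ 2 / (4 * L) := by
      field_simp
      ring
    have hnn : 0 ≤ (‖g - g'‖ - 2 * L * ‖r‖) ^ 2 / (4 * L) := by positivity
    linarith [real_inner_le_norm (g - g') r]
  rw [show y + q - (y + q - r) = r by abel, show y + q - y = q by abel,
    show y - (y + q - r) = r - q by abel, norm_sub_sq_real, real_inner_comm q r]
  rw [inner_sub_left] at hyoung
  linarith

/-- Under Assumptions 1 and 2, let `x*` be the minimizer of `C(·;θ)` over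
`X^T` and let `ρ = 1 − α/(4L)`, `ζ = h²/α + h²/(2L)` with `L = l_f + 2 l_d`. For any
`y ∈ X^T` and any inexact parameter `θ' ∈ Θ^T`, the one-step inexact projected gradient update
`z = Π_{X^T}[y − (1/(2L)) ∇_x C(y;θ')]` satisfies
`C(z;θ) − C(x*;θ) ≤ L ρ ‖y − x*‖² + ζ ‖θ' − θ‖²`. -/
theorem stmt5 {n p : ℕ} (T : ℕ) (hT : 1 ≤ T)
    (X : Set (EuclideanSpace ℝ (Fin n))) (Θ : Set (EuclideanSpace ℝ (Fin p)))
    (hXne : X.Nonempty) (hXcl : IsClosed X) (hXcv : Convex ℝ X)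
    (x₀ : EuclideanSpace ℝ (Fin n)) (hx₀ : x₀ ∈ X)
    (f : EuclideanSpace ℝ (Fin n) → EuclideanSpace ℝ (Fin p) → ℝ)
    (d : EuclideanSpace ℝ (Fin n) → EuclideanSpace ℝ (Fin n) → ℝ)
    (Gf : EuclideanSpace ℝ (Fin n) → EuclideanSpace ℝ (Fin p) → EuclideanSpace ℝ (Fin n))
    (Gd1 Gd2 : EuclideanSpace ℝ (Fin n) → EuclideanSpace ℝ (Fin n) → EuclideanSpace ℝ (Fin n))
    (α lf ld h : ℝ) (hα : 0 < α) (hlf : 0 ≤ lf) (hld : 0 ≤ ld)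
    -- Assumption 1: `f(·;θ)` is `α`-strongly convex on `X` for every `θ ∈ Θ`
    (hfsc : ∀ θ ∈ Θ, ∀ x ∈ X, ∀ y ∈ X,
      f y θ ≥ f x θ + ⟪Gf x θ, y - x⟫ + α / 2 * ‖y - x‖ ^ 2)
    -- Assumption 1: `f(·;θ)` is `l_f`-smooth on `X` for every `θ ∈ Θ`
    (hfsm : ∀ θ ∈ Θ, ∀ x ∈ X, ∀ y ∈ X, ‖Gf x θ - Gf y θ‖ ≤ lf * ‖x - y‖)
    -- Assumption 1: `d` is jointly convex on `X × X`
    (hdcv : ∀ a ∈ X, ∀ b ∈ X, ∀ a' ∈ X, ∀ b' ∈ X,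
      d a' b' ≥ d a b + ⟪Gd1 a b, a' - a⟫ + ⟪Gd2 a b, b' - b⟫)
    -- Assumption 1: `d` is `l_d`-smooth on `X × X` (Euclidean norm on the product)
    (hdsm : ∀ a ∈ X, ∀ b ∈ X, ∀ a' ∈ X, ∀ b' ∈ X,
      ‖Gd1 a b - Gd1 a' b'‖ ^ 2 + ‖Gd2 a b - Gd2 a' b'‖ ^ 2
        ≤ ld ^ 2 * (‖a - a'‖ ^ 2 + ‖b - b'‖ ^ 2))
    -- Assumption 2: `∇_x f(x;·)` is `h`-Lipschitz in the parameter
    (hlip : ∀ x ∈ X, ∀ θ ∈ Θ, ∀ θ' ∈ Θ, ‖Gf x θ - Gf x θ'‖ ≤ h * ‖θ - θ'‖)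
    (L ρ ζ : ℝ) (hLdef : L = lf + 2 * ld) (hαL : α ≤ L)
    (hρdef : ρ = 1 - α / (4 * L)) (hζdef : ζ = h ^ 2 / α + h ^ 2 / (2 * L))
    (θ θ' : ℕ → EuclideanSpace ℝ (Fin p))
    (hθ : ∀ t ∈ Finset.Icc 1 T, θ t ∈ Θ) (hθ' : ∀ t ∈ Finset.Icc 1 T, θ' t ∈ Θ)
    -- `x* = argmin_{x ∈ X^T} C(x;θ)`
    (xstar : ℕ → EuclideanSpace ℝ (Fin n))
    (hxstar0 : xstar 0 = x₀) (hxstarX : ∀ t ∈ Finset.Icc 1 T, xstar t ∈ X)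
    (hxstaropt : ∀ w : ℕ → EuclideanSpace ℝ (Fin n),
      w 0 = x₀ → (∀ t ∈ Finset.Icc 1 T, w t ∈ X) →
      socoCost T f d θ xstar ≤ socoCost T f d θ w)
    (y : ℕ → EuclideanSpace ℝ (Fin n))
    (hy0 : y 0 = x₀) (hyX : ∀ t ∈ Finset.Icc 1 T, y t ∈ X)
    -- `z = Π_{X^T}[y − (1/(2L)) ∇_x C(y;θ')]`, characterized as the point of `X^T` nearest
    -- (in the Euclidean product norm) to the inexact gradient step
    (z : ℕ → EuclideanSpace ℝ (Fin n))
    (hz0 : z 0 = x₀) (hzX : ∀ t ∈ Finset.Icc 1 T, z t ∈ X)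
    (hzproj : ∀ w : ℕ → EuclideanSpace ℝ (Fin n),
      w 0 = x₀ → (∀ t ∈ Finset.Icc 1 T, w t ∈ X) →
      ∑ t ∈ Finset.Icc 1 T,
          ‖z t - (y t - (1 / (2 * L)) • socoGrad T Gf Gd1 Gd2 θ' y t)‖ ^ 2
        ≤ ∑ t ∈ Finset.Icc 1 T,
          ‖w t - (y t - (1 / (2 * L)) • socoGrad T Gf Gd1 Gd2 θ' y t)‖ ^ 2) :
    socoCost T f d θ z - socoCost T f d θ xstar
      ≤ L * ρ * ∑ t ∈ Finset.Icc 1 T, ‖y t - xstar t‖ ^ 2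
        + ζ * ∑ t ∈ Finset.Icc 1 T, ‖θ' t - θ t‖ ^ 2 := by
  have hL : 0 < L := hα.trans_le hαL
  have extend : ∀ w : ℕ → EuclideanSpace ℝ (Fin n), w 0 = x₀ →
      (∀ t ∈ Finset.Icc 1 T, w t ∈ X) → ∀ t ≤ T, w t ∈ X := by
    intro w hw0 hwX t ht
    rcases Nat.eq_zero_or_pos t with rfl | hpos
    · rwa [hw0]
    · exact hwX t (Finset.mem_Icc.mpr ⟨hpos, ht⟩)
  have hzX' := extend z hz0 hzX
  have hyX' := extend y hy0 hyX
  have hxX' := extend xstar hxstar0 hxstarX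
  have hupper := socoCost_le_add hα.le hld hfsc hfsm hdcv hdsm hθ (hz0.trans hy0.symm) hzX' hyX'
  have hlower := socoCost_add_le hfsc hdcv hθ (hxstar0.trans hy0.symm) hxX' hyX'
  have hvi : ∀ t ∈ Finset.Icc 1 T,
      ⟪y t - (1 / (2 * L)) • socoGrad T Gf Gd1 Gd2 θ' y t - z t, xstar t - z t⟫ ≤ 0 := by
    intro t ht
    refine inner_sub_sub_nonpos_of_forall_norm_le hXcv (hzX t ht) (fun v hv => ?_) (hxstarX t ht)
    have ht0 : (0 : ℕ) ≠ t := by have := (Finset.mem_Icc.mp ht).1; omega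
    have hcmp := hzproj (Function.update z t v) (by rw [Function.update_of_ne ht0, hz0])
      (fun s hs => by
        by_cases hst : s = t
        · subst hst; simpa using hv
        · rw [Function.update_of_ne hst]; exact hzX s hs)
    rw [← Finset.add_sum_erase _ _ ht, ← Finset.add_sum_erase _ _ ht, Function.update_self,
      Finset.sum_congr rfl fun s hs => by
        rw [← Function.update_of_ne (Finset.ne_of_mem_erase hs) v z]] at hcmp
    exact le_of_add_le_add_right hcmp
  have hsum : ∑ t ∈ Finset.Icc 1 T, (⟪socoGrad T Gf Gd1 Gd2 θ y t, z t - xstar t⟫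
        + L * ‖z t - y t‖ ^ 2 - α / 2 * ‖xstar t - y t‖ ^ 2)
      ≤ ∑ t ∈ Finset.Icc 1 T, (L * ρ * ‖y t - xstar t‖ ^ 2 + ζ * ‖θ' t - θ t‖ ^ 2) := by
    refine Finset.sum_le_sum fun t ht => ?_
    have hstep := inner_add_norm_sq_le_of_projected_step (g := socoGrad T Gf Gd1 Gd2 θ y t)
      hL (hvi t ht)
    have herr : ‖socoGrad T Gf Gd1 Gd2 θ y t - socoGrad T Gf Gd1 Gd2 θ' y t‖ ^ 2
        ≤ h ^ 2 * ‖θ' t - θ t‖ ^ 2 := by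
      have e : socoGrad T Gf Gd1 Gd2 θ y t - socoGrad T Gf Gd1 Gd2 θ' y t
          = Gf (y t) (θ t) - Gf (y t) (θ' t) := by
        unfold socoGrad; abel
      rw [e, norm_sub_rev (θ' t), ← mul_pow]
      exact pow_le_pow_left₀ (norm_nonneg _)
        (hlip (y t) (hyX t ht) (θ t) (hθ t ht) (θ' t) (hθ' t ht)) 2
    have hζ : h ^ 2 * ‖θ' t - θ t‖ ^ 2 / (4 * L) ≤ ζ * ‖θ' t - θ t‖ ^ 2 := by
      have e : ζ * ‖θ' t - θ t‖ ^ 2 = h ^ 2 * ‖θ' t - θ t‖ ^ 2 / (4 * L)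
          + (h ^ 2 * ‖θ' t - θ t‖ ^ 2 / α + h ^ 2 * ‖θ' t - θ t‖ ^ 2 / (4 * L)) := by
        rw [hζdef]; field_simp; ring
      rw [e]
      exact le_add_of_nonneg_right (by positivity)
    have hρ : L * ρ = L - α / 4 := by
      rw [hρdef]; field_simp
    have hdiv := div_le_div_of_nonneg_right herr (by positivity : 0 ≤ 4 * L)
    have hsq : 0 ≤ α / 4 * ‖y t - xstar t‖ ^ 2 := by positivity
    rw [hρ, norm_sub_rev (xstar t)]
    linarith
  have hsplit : ∑ t ∈ Finset.Icc 1 T, ⟪socoGrad T Gf Gd1 Gd2 θ y t, z t - xstar t⟫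
      = ∑ t ∈ Finset.Icc 1 T, ⟪socoGrad T Gf Gd1 Gd2 θ y t, z t - y t⟫
        - ∑ t ∈ Finset.Icc 1 T, ⟪socoGrad T Gf Gd1 Gd2 θ y t, xstar t - y t⟫ := by
    rw [← Finset.sum_sub_distrib]
    refine Finset.sum_congr rfl fun t _ => ?_
    rw [← inner_sub_right, sub_sub_sub_cancel_right]
  rw [Finset.sum_sub_distrib, Finset.sum_add_distrib, Finset.sum_add_distrib, ← Finset.mul_sum,
    ← Finset.mul_sum, ← Finset.mul_sum, ← Finset.mul_sum, hsplit] at hsum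
  rw [← hLdef] at hupper
  linarith
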